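/- Let p be a probability kernel on ℤ^d with continuous-time transition kernel p_t, let γ ≥ 0, T > 0, x₀ ∈ ℤ^d, and let t ∈ [0,T) be such that p_{T−t}(z) > 0 for all z ∈ ℤ^d. Let η : ℤ^d → ℕ be finitely supported and not identically 0, set h(η,t) := ∑_x η(x)·p_{T−t}(x₀−x) and s_x(η,t) := p_{T−t}(x₀−x)/h(η,t). Then for every bounded function f on configurations, the derivative (∂/∂t)h(η,t) exists and the following identity holds (all series converging absolutely): (1/h(η,t))·[ ∑_{x,y} η(x)·p(y−x)·(h(η^{x→y},t)·f(η^{x→y}) − h(η,t)·f(η)) + (γ/2)·∑_x 1_{η(x)=1}·(h(η^{+x},t)·f(η^{+x}) + h(η^{−x},t)·f(η^{−x}) − 2h(η,t)·f(η)) + f(η)·(∂/∂t)h(η,t) ] = ∑_{x,y} η(x)·p(y−x)·(1 − s_x(η,t) + s_x(η,t)·p_{T−t}(x₀−y)/p_{T−t}(x₀−x))·(f(η^{x→y}) − f(η)) + (γ/2)·∑_x 1_{η(x)=1}·[ (1+s_x(η,t))·(f(η^{+x}) − f(η)) + (1−s_x(η,t))·(f(η^{−x}) − f(η)) ]. -/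

import Mathlib

noncomputable def convPow {G : Type*} [AddCommGroup G] [DecidableEq G] (p : G → ℝ) : ℕ → G → ℝ
  | 0 => fun x => if x = 0 then (1 : ℝ) else 0
  | n + 1 => fun x => ∑' y, convPow p n y * p (x - y)

noncomputable def ctKernel {G : Type*} [AddCommGroup G] [DecidableEq G] (p : G → ℝ) (t : ℝ)
    (x : G) : ℝ :=
  Real.exp (-t) * ∑' n : ℕ, t ^ n / (Nat.factorial n : ℝ) * convPow p n x

/-- `η^{x→y}`: one particle moved from `x` to `y`. -/
noncomputable def moveTo {G : Type*} [DecidableEq G] (η : G →₀ ℕ) (x y : G) : G →₀ ℕ :=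
  η - Finsupp.single x 1 + Finsupp.single y 1

/-- `η^{+x}`: one particle added at `x`. -/
noncomputable def addAt {G : Type*} [DecidableEq G] (η : G →₀ ℕ) (x : G) : G →₀ ℕ :=
  η + Finsupp.single x 1

/-- `η^{−x}`: one particle removed at `x`. -/
noncomputable def subAt {G : Type*} [DecidableEq G] (η : G →₀ ℕ) (x : G) : G →₀ ℕ :=
  η - Finsupp.single x 1

section ContinuousTimeKernel

theorem summable_of_tsum_eq_one {ι : Type*} {p : ι → ℝ} (hp1 : ∑' x, p x = 1) : Summable p := by
  by_contra h
  simp [tsum_eq_zero_of_not_summable h] at hp1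

theorem hasSum_sub_left {G : Type*} [AddCommGroup G] {p : G → ℝ} (hp1 : ∑' x, p x = 1) (x : G) :
    HasSum (fun y => p (x - y)) 1 := by
  have h := (summable_of_tsum_eq_one hp1).hasSum
  rw [hp1] at h
  exact (Equiv.subLeft x).hasSum_iff.mpr h

variable {G : Type*} [AddCommGroup G] [DecidableEq G] {p : G → ℝ}

theorem convPow_nonneg (hp : ∀ x, 0 ≤ p x) (n : ℕ) (x : G) : 0 ≤ convPow p n x := by
  induction n generalizing x with
  | zero => simp only [convPow]; split_ifs <;> norm_num
  | succ n ih => exact tsum_nonneg fun y => mul_nonneg (ih y) (hp _)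

theorem convPow_le_one (hp : ∀ x, 0 ≤ p x) (hp1 : ∑' x, p x = 1) (n : ℕ) (x : G) :
    convPow p n x ≤ 1 := by
  induction n generalizing x with
  | zero => simp only [convPow]; split_ifs <;> norm_num
  | succ n ih =>
    have hs := hasSum_sub_left hp1 x
    have hle : ∀ y, convPow p n y * p (x - y) ≤ p (x - y) := fun y =>
      mul_le_of_le_one_left (hp _) (ih y)
    rw [← hs.tsum_eq]
    exact (hs.summable.of_nonneg_of_le
      (fun y => mul_nonneg (convPow_nonneg hp n y) (hp _)) hle).tsum_le_tsum hle hs.summable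

theorem hasDerivAt_tsum_pow_div_factorial {c : ℕ → ℝ} (hc : ∀ n, |c n| ≤ 1) (s : ℝ) :
    HasDerivAt (fun r : ℝ => ∑' n : ℕ, r ^ n / (Nat.factorial n : ℝ) * c n)
      (∑' n : ℕ, s ^ n / (Nat.factorial n : ℝ) * c (n + 1)) s := by
  set R : ℝ := |s| + 1 with hR
  have hR0 : 0 ≤ R := by positivity
  have hshift : ∀ (r : ℝ) (n : ℕ), ((n + 1 : ℕ) : ℝ) * r ^ (n + 1 - 1) / (Nat.factorial (n + 1) : ℝ)
      = r ^ n / (Nat.factorial n : ℝ) := by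
    intro r n
    rw [Nat.factorial_succ]
    have : (Nat.factorial n : ℝ) ≠ 0 := by positivity
    push_cast
    field_simp
  have hu : Summable fun n : ℕ => (n : ℝ) * R ^ (n - 1) / (Nat.factorial n : ℝ) := by
    refine (summable_nat_add_iff 1).mp ?_
    refine Summable.congr ?_ fun n => (hshift R n).symm
    exact Real.summable_pow_div_factorial R
  have hmem : s ∈ Metric.ball (0 : ℝ) R := by simp [hR]
  have hbound : ∀ (n : ℕ) (r : ℝ), r ∈ Metric.ball (0 : ℝ) R →
      ‖(n : ℝ) * r ^ (n - 1) / (Nat.factorial n : ℝ) * c n‖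
        ≤ (n : ℝ) * R ^ (n - 1) / (Nat.factorial n : ℝ) := by
    intro n r hr
    have hr' : |r| ≤ R := by simpa using (Metric.mem_ball.mp hr).le
    rw [norm_mul, norm_div, norm_mul, norm_pow]
    simp only [Real.norm_eq_abs, Nat.abs_cast]
    calc _ ≤ (n : ℝ) * |r| ^ (n - 1) / (Nat.factorial n : ℝ) :=
          mul_le_of_le_one_right (by positivity) (hc n)
      _ ≤ _ := by gcongr
  have h := hasDerivAt_tsum_of_isPreconnected (y₀ := s) hu Metric.isOpen_ball
    (convex_ball (0 : ℝ) R).isPreconnected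
    (g := fun (n : ℕ) (r : ℝ) => r ^ n / (Nat.factorial n : ℝ) * c n)
    (fun n r _ => ((hasDerivAt_pow n r).div_const _).mul_const _) hbound hmem
    (by
      refine (Real.summable_pow_div_factorial |s|).of_norm_bounded fun n => ?_
      rw [norm_mul, norm_div, norm_pow]
      simp only [Real.norm_eq_abs, Nat.abs_cast]
      exact mul_le_of_le_one_right (by positivity) (hc n)) hmem
  have hs := hu.of_norm_bounded fun n => hbound n s hmem
  rw [hs.tsum_eq_zero_add] at h
  simpa only [hshift, Nat.cast_zero, zero_mul, zero_div, zero_add] using h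

theorem abs_convPow_le_one (hp : ∀ x, 0 ≤ p x) (hp1 : ∑' x, p x = 1) (n : ℕ) (x : G) :
    |convPow p n x| ≤ 1 := by
  rw [abs_of_nonneg (convPow_nonneg hp n x)]
  exact convPow_le_one hp hp1 n x

theorem ctKernel_le_one (hp : ∀ x, 0 ≤ p x) (hp1 : ∑' x, p x = 1) {s : ℝ} (hs : 0 ≤ s) (x : G) :
    ctKernel p s x ≤ 1 := by
  have hle : ∀ n : ℕ, s ^ n / (Nat.factorial n : ℝ) * convPow p n x
      ≤ s ^ n / (Nat.factorial n : ℝ) := fun n =>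
    mul_le_of_le_one_right (by positivity) (convPow_le_one hp hp1 n x)
  have hsum := Real.summable_pow_div_factorial s
  have h : ∑' n : ℕ, s ^ n / (Nat.factorial n : ℝ) * convPow p n x ≤ Real.exp s := by
    rw [Real.exp_eq_exp_ℝ, NormedSpace.exp_eq_tsum_div]
    exact (hsum.of_nonneg_of_le
      (fun n => mul_nonneg (by positivity) (convPow_nonneg hp n x)) hle).tsum_le_tsum hle hsum
  calc ctKernel p s x ≤ Real.exp (-s) * Real.exp s := by
        unfold ctKernel; gcongr
    _ = 1 := by rw [← Real.exp_add]; simp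

/-- The Kolmogorov equation for the continuous-time kernel. -/
theorem hasDerivAt_ctKernel (hp : ∀ x, 0 ≤ p x) (hp1 : ∑' x, p x = 1) (s : ℝ) (x : G) :
    HasDerivAt (fun r => ctKernel p r x)
      ((∑' y, ctKernel p s y * p (x - y)) - ctKernel p s x) s := by
  have hsum : Summable fun q : ℕ × G =>
      s ^ q.1 / (Nat.factorial q.1 : ℝ) * (convPow p q.1 q.2 * p (x - q.2)) := by
    have hb : Summable fun q : ℕ × G => |s| ^ q.1 / (Nat.factorial q.1 : ℝ) * p (x - q.2) :=
      (Real.summable_pow_div_factorial |s|).mul_of_nonneg (hasSum_sub_left hp1 x).summable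
        (fun n => by positivity) (fun y => hp _)
    refine hb.of_norm_bounded fun q => ?_
    rw [norm_mul, norm_mul, norm_div, norm_pow]
    simp only [Real.norm_eq_abs, Nat.abs_cast, abs_of_nonneg (hp _)]
    gcongr
    exact mul_le_of_le_one_left (hp _) (abs_convPow_le_one hp hp1 _ _)
  have hswap : ∑' y, ctKernel p s y * p (x - y)
      = Real.exp (-s) * ∑' n : ℕ, s ^ n / (Nat.factorial n : ℝ) * convPow p (n + 1) x := by
    have hcomm := Summable.tsum_comm (f := fun (n : ℕ) (y : G) =>
      s ^ n / (Nat.factorial n : ℝ) * (convPow p n y * p (x - y))) hsum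
    simp only [ctKernel, convPow, mul_assoc, tsum_mul_left, ← tsum_mul_right]
    simp only [tsum_mul_left] at hcomm
    rw [← hcomm]
  have h := ((Real.hasDerivAt_exp (-s)).comp s (hasDerivAt_neg s)).mul
    (hasDerivAt_tsum_pow_div_factorial (fun n => abs_convPow_le_one hp hp1 n x) s)
  refine HasDerivAt.congr_deriv h ?_
  rw [hswap]
  simp only [ctKernel, Function.comp]
  ring

end ContinuousTimeKernel

section Configurations

theorem Summable.mul_of_abs_le {ι : Type*} {w g : ι → ℝ} (hw : Summable w) (hw0 : ∀ i, 0 ≤ w i)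
    {C : ℝ} (hg : ∀ i, |g i| ≤ C) : Summable fun i => w i * g i :=
  (hw.mul_right C).of_norm_bounded fun i => by
    rw [norm_mul, Real.norm_of_nonneg (hw0 i), Real.norm_eq_abs]
    exact mul_le_mul_of_nonneg_left (hg i) (hw0 i)

theorem tsum_natCast_mul_eq_sum {G : Type*} (ξ : G →₀ ℕ) (a : G → ℝ) :
    ∑' x, (ξ x : ℝ) * a x = ξ.sum fun x n => (n : ℝ) * a x :=
  tsum_eq_sum fun x hx => by simp [Finsupp.notMem_support_iff.mp hx]

theorem tsum_addAt {G : Type*} [DecidableEq G] (ξ : G →₀ ℕ) (a : G → ℝ) (y : G) :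
    ∑' x, (addAt ξ y x : ℝ) * a x = (∑' x, (ξ x : ℝ) * a x) + a y := by
  simp only [tsum_natCast_mul_eq_sum, addAt]
  rw [Finsupp.sum_add_index' (by simp) (by intros; push_cast; ring)]
  simp

theorem tsum_subAt {G : Type*} [DecidableEq G] (ξ : G →₀ ℕ) (a : G → ℝ) {y : G} (hy : ξ y ≠ 0) :
    ∑' x, (subAt ξ y x : ℝ) * a x = (∑' x, (ξ x : ℝ) * a x) - a y := by
  have h : addAt (subAt ξ y) y = ξ :=
    tsub_add_cancel_of_le (by simpa [Finsupp.single_le_iff] using Nat.one_le_iff_ne_zero.mpr hy)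
  have := tsum_addAt (subAt ξ y) a y
  rw [h] at this
  linarith

theorem tsum_moveTo {G : Type*} [DecidableEq G] (ξ : G →₀ ℕ) (a : G → ℝ) {x : G} (hx : ξ x ≠ 0) (y : G) :
    ∑' z, (moveTo ξ x y z : ℝ) * a z = (∑' z, (ξ z : ℝ) * a z) - a x + a y := by
  rw [← tsum_subAt ξ a hx]
  exact tsum_addAt (subAt ξ x) a y

theorem summable_natCast_mul_sub {G : Type*} [AddCommGroup G] {p : G → ℝ} (hp : ∀ x, 0 ≤ p x) (hp1 : ∑' x, p x = 1)
    (η : G →₀ ℕ) : Summable fun q : G × G => (η q.1 : ℝ) * p (q.2 - q.1) := by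
  have hη : Summable fun x => (η x : ℝ) :=
    summable_of_ne_finset_zero (s := η.support) fun x hx => by
      simp [Finsupp.notMem_support_iff.mp hx]
  have h := hη.mul_of_nonneg (summable_of_tsum_eq_one hp1) (fun x => Nat.cast_nonneg _) hp
  exact (Equiv.prodShear (Equiv.refl G) fun x => Equiv.subRight x).summable_iff.mpr h

/-- The jump part of the generator applied to the linear functional `η ↦ ∑ η(x) a(x)`. -/
theorem tsum_natCast_mul_sub {G : Type*} [AddCommGroup G] {p : G → ℝ} (hp : ∀ x, 0 ≤ p x) (hp1 : ∑' x, p x = 1)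
    (η : G →₀ ℕ) {a : G → ℝ} {C : ℝ} (ha : ∀ x, |a x| ≤ C) :
    ∑' q : G × G, (η q.1 : ℝ) * p (q.2 - q.1) * (a q.2 - a q.1)
      = ∑ x ∈ η.support, (η x : ℝ) * ((∑' y, p (y - x) * a y) - a x) := by
  have hsum : Summable fun q : G × G => (η q.1 : ℝ) * p (q.2 - q.1) * (a q.2 - a q.1) :=
    (summable_natCast_mul_sub hp hp1 η).mul_of_abs_le
      (fun q => mul_nonneg (Nat.cast_nonneg _) (hp _)) (C := C + C) fun q =>
      (abs_sub _ _).trans (add_le_add (ha q.2) (ha q.1))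
  rw [hsum.tsum_prod, tsum_eq_sum (s := η.support) fun x hx => by
    simp [Finsupp.notMem_support_iff.mp hx]]
  refine Finset.sum_congr rfl fun x _ => ?_
  have hpx : HasSum (fun y => p (y - x)) 1 := by
    have h := (summable_of_tsum_eq_one hp1).hasSum
    rw [hp1] at h
    exact (Equiv.subRight x).hasSum_iff.mpr h
  have hpa : Summable fun y => p (y - x) * a y := hpx.summable.mul_of_abs_le (fun y => hp _) ha
  simp only [mul_assoc]
  rw [tsum_mul_left]
  simp only [mul_sub (p _)]
  rw [hpa.tsum_sub (hpx.summable.mul_right _), tsum_mul_right, hpx.tsum_eq]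
  ring

/-- The time derivative of the linear functional
`η ↦ ∑ η(x) p_{T-t}(x₀-x)` is minus its image under the jump part of the generator. -/
theorem hasDerivAt_tsum_natCast_mul_ctKernel {G : Type*} [AddCommGroup G] [DecidableEq G]
    {p : G → ℝ} (hp : ∀ x, 0 ≤ p x)
    (hp1 : ∑' x, p x = 1) {T t : ℝ} (htT : t < T) (hpos : ∀ z, 0 < ctKernel p (T - t) z)
    (x₀ : G) (η : G →₀ ℕ) :
    HasDerivAt (fun s => ∑' x, (η x : ℝ) * ctKernel p (T - s) (x₀ - x))
      (-∑' q : G × G, (η q.1 : ℝ) * p (q.2 - q.1) *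
        (ctKernel p (T - t) (x₀ - q.2) - ctKernel p (T - t) (x₀ - q.1))) t := by
  rw [tsum_natCast_mul_sub hp hp1 η (a := fun x => ctKernel p (T - t) (x₀ - x)) (C := 1) fun x => by
    rw [abs_of_pos (hpos _)]; exact ctKernel_le_one hp hp1 (sub_nonneg.mpr htT.le) _]
  simp only [tsum_natCast_mul_eq_sum, Finsupp.sum, ← Finset.sum_neg_distrib]
  refine HasDerivAt.fun_sum fun x _ => ?_
  have h := ((hasDerivAt_ctKernel hp hp1 (T - t) (x₀ - x)).comp t
    ((hasDerivAt_id t).const_sub T)).const_mul (η x : ℝ)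
  have hswap : ∑' y, ctKernel p (T - t) y * p (x₀ - x - y)
      = ∑' y, p (y - x) * ctKernel p (T - t) (x₀ - y) := by
    rw [← (Equiv.subLeft x₀).tsum_eq]
    refine tsum_congr fun y => ?_
    rw [mul_comm, Equiv.subLeft_apply]
    congr 2
    abel
  rw [hswap] at h
  exact HasDerivAt.congr_deriv h (by ring)

end Configurations

/-- explicit form of the Doob `h`-transform of the lonely branching random walk
generator, with `h(η,t) = ∑_x η(x) p_{T−t}(x₀−x)` and `s_x(η,t) = p_{T−t}(x₀−x)/h(η,t)`. -/
theorem stmt_17 (d : ℕ) (hd : 1 ≤ d)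
    (p : (Fin d → ℤ) → ℝ) (hp : ∀ x, 0 ≤ p x) (hp1 : ∑' x, p x = 1)
    (γ : ℝ) (hγ : 0 ≤ γ) (T : ℝ) (hT : 0 < T) (x₀ : Fin d → ℤ)
    (t : ℝ) (ht0 : 0 ≤ t) (htT : t < T)
    (hpos : ∀ z : Fin d → ℤ, 0 < ctKernel p (T - t) z)
    (η : (Fin d → ℤ) →₀ ℕ) (hη : η ≠ 0)
    (H : ((Fin d → ℤ) →₀ ℕ) → ℝ → ℝ)
    (hH : ∀ η' s, H η' s = ∑' x : Fin d → ℤ, (η' x : ℝ) * ctKernel p (T - s) (x₀ - x))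
    (sel : ((Fin d → ℤ) →₀ ℕ) → (Fin d → ℤ) → ℝ)
    (hsel : ∀ η' x, sel η' x = ctKernel p (T - t) (x₀ - x) / H η' t)
    (f : ((Fin d → ℤ) →₀ ℕ) → ℝ) (hf : ∃ C : ℝ, ∀ ξ, |f ξ| ≤ C) :
    (Summable fun xy : (Fin d → ℤ) × (Fin d → ℤ) =>
      (η xy.1 : ℝ) * p (xy.2 - xy.1) *
        (H (moveTo η xy.1 xy.2) t * f (moveTo η xy.1 xy.2) - H η t * f η)) ∧
    (Summable fun x : Fin d → ℤ =>
      if η x = 1 then H (addAt η x) t * f (addAt η x) + H (subAt η x) t * f (subAt η x)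
        - 2 * H η t * f η else 0) ∧
    (Summable fun xy : (Fin d → ℤ) × (Fin d → ℤ) =>
      (η xy.1 : ℝ) * p (xy.2 - xy.1) *
        (1 - sel η xy.1 + sel η xy.1 *
          (ctKernel p (T - t) (x₀ - xy.2) / ctKernel p (T - t) (x₀ - xy.1))) *
        (f (moveTo η xy.1 xy.2) - f η)) ∧
    (Summable fun x : Fin d → ℤ =>
      if η x = 1 then (1 + sel η x) * (f (addAt η x) - f η)
        + (1 - sel η x) * (f (subAt η x) - f η) else 0) ∧
    ∃ hd' : ℝ, HasDerivAt (fun s => H η s) hd' t ∧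
      (1 / H η t) *
        ((∑' xy : (Fin d → ℤ) × (Fin d → ℤ),
            (η xy.1 : ℝ) * p (xy.2 - xy.1) *
              (H (moveTo η xy.1 xy.2) t * f (moveTo η xy.1 xy.2) - H η t * f η))
          + (γ / 2) * (∑' x : Fin d → ℤ,
              if η x = 1 then H (addAt η x) t * f (addAt η x)
                + H (subAt η x) t * f (subAt η x) - 2 * H η t * f η else 0)
          + f η * hd')
      = (∑' xy : (Fin d → ℤ) × (Fin d → ℤ),
            (η xy.1 : ℝ) * p (xy.2 - xy.1) *
              (1 - sel η xy.1 + sel η xy.1 *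
                (ctKernel p (T - t) (x₀ - xy.2) / ctKernel p (T - t) (x₀ - xy.1))) *
              (f (moveTo η xy.1 xy.2) - f η))
        + (γ / 2) * (∑' x : Fin d → ℤ,
            if η x = 1 then (1 + sel η x) * (f (addAt η x) - f η)
              + (1 - sel η x) * (f (subAt η x) - f η) else 0) := by
  obtain ⟨C, hC⟩ := hf
  set a : (Fin d → ℤ) → ℝ := fun x => ctKernel p (T - t) (x₀ - x) with ha
  have ha0 : ∀ x, 0 < a x := fun x => hpos _
  have ha1 : ∀ x, a x ≤ 1 := fun x => ctKernel_le_one hp hp1 (sub_nonneg.mpr htT.le) _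
  set h : ℝ := H η t with hh
  have hη' : h = ∑' x, (η x : ℝ) * a x := hH η t
  have hadd : ∀ x, H (addAt η x) t = h + a x := fun x => by
    rw [hη', hH]; exact tsum_addAt η a x
  have hsub : ∀ x, η x ≠ 0 → H (subAt η x) t = h - a x := fun x hx => by
    rw [hη', hH]; exact tsum_subAt η a hx
  have hmove : ∀ x y, η x ≠ 0 → H (moveTo η x y) t = h - a x + a y := fun x y hx => by
    rw [hη', hH]; exact tsum_moveTo η a hx y
  have hh0 : 0 < h := by
    rw [hη', tsum_natCast_mul_eq_sum]
    refine Finset.sum_pos (fun x hx => ?_) (Finsupp.support_nonempty_iff.mpr hη)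
    exact mul_pos (Nat.cast_pos.mpr (Nat.pos_of_ne_zero (Finsupp.mem_support_iff.mp hx))) (ha0 x)
  have hs : ∀ x, sel η x = a x / h := fun x => hsel η x
  set w : (Fin d → ℤ) × (Fin d → ℤ) → ℝ := fun q => (η q.1 : ℝ) * p (q.2 - q.1) with hw
  have hw0 : ∀ q, 0 ≤ w q := fun q => mul_nonneg (Nat.cast_nonneg _) (hp _)
  have hwsum : Summable w := summable_natCast_mul_sub hp hp1 η
  have hdiff : ∀ x y, |a y - a x| ≤ 1 := fun x y => by
    rw [abs_le]; constructor <;> linarith [ha0 x, ha0 y, ha1 x, ha1 y]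
  have hdf : ∀ ξ, |f ξ - f η| ≤ C + C := fun ξ =>
    (abs_sub _ _).trans (add_le_add (hC ξ) (hC η))
  -- the transformed jump rates
  have hrate : ∀ x y, 1 - sel η x + sel η x * (a y / a x) = (h + (a y - a x)) / h := fun x y => by
    rw [hs]
    have := (ha0 x).ne'
    field_simp
    ring
  have hJ : Summable fun q : (Fin d → ℤ) × (Fin d → ℤ) =>
      w q * ((h + (a q.2 - a q.1)) / h * (f (moveTo η q.1 q.2) - f η)) := by
    refine hwsum.mul_of_abs_le hw0 (C := (h + 1) / h * (C + C)) fun q => ?_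
    rw [abs_mul, abs_div, abs_of_pos hh0]
    refine mul_le_mul ?_ (hdf _) (abs_nonneg _) (by positivity)
    gcongr
    exact (abs_add_le _ _).trans (add_le_add (abs_of_pos hh0).le (hdiff _ _))
  have hA : Summable fun q : (Fin d → ℤ) × (Fin d → ℤ) => w q * (a q.2 - a q.1) :=
    hwsum.mul_of_abs_le hw0 fun q => hdiff q.1 q.2
  have hjump : (fun q : (Fin d → ℤ) × (Fin d → ℤ) =>
      w q * (H (moveTo η q.1 q.2) t * f (moveTo η q.1 q.2) - h * f η)) = fun q =>
      h * (w q * ((h + (a q.2 - a q.1)) / h * (f (moveTo η q.1 q.2) - f η)))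
        + f η * (w q * (a q.2 - a q.1)) := by
    funext q
    by_cases hq : η q.1 = 0
    · simp [hw, hq]
    · rw [hmove _ _ hq]
      field_simp
      ring
  have hjump' : (fun q : (Fin d → ℤ) × (Fin d → ℤ) =>
      w q * (1 - sel η q.1 + sel η q.1 * (a q.2 / a q.1)) * (f (moveTo η q.1 q.2) - f η)) = fun q =>
      w q * ((h + (a q.2 - a q.1)) / h * (f (moveTo η q.1 q.2) - f η)) := by
    funext q
    rw [hrate, mul_assoc]
  have hbranch : (fun x : Fin d → ℤ =>
      if η x = 1 then H (addAt η x) t * f (addAt η x) + H (subAt η x) t * f (subAt η x)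
        - 2 * h * f η else 0) = fun x => h * (if η x = 1 then
          (1 + sel η x) * (f (addAt η x) - f η) + (1 - sel η x) * (f (subAt η x) - f η) else 0) := by
    funext x
    split_ifs with hx
    · rw [hadd, hsub x (by simp [hx]), hs]
      field_simp
      ring
    · simp
  have hB : Summable fun x : Fin d → ℤ => if η x = 1 then
      (1 + sel η x) * (f (addAt η x) - f η) + (1 - sel η x) * (f (subAt η x) - f η) else 0 :=
    summable_of_ne_finset_zero (s := η.support) fun x hx => by
      simp [Finsupp.notMem_support_iff.mp hx]
  have hder := hasDerivAt_tsum_natCast_mul_ctKernel hp hp1 htT hpos x₀ η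
  simp only [← hH] at hder
  refine ⟨?_, ?_, ?_, hB, _, hder, ?_⟩
  · exact hjump ▸ (hJ.mul_left h).add (hA.mul_left (f η))
  · exact hbranch ▸ hB.mul_left h
  · exact hjump' ▸ hJ
  · have e1 := congrArg tsum hjump
    have e2 := congrArg tsum hjump'
    have e3 := congrArg tsum hbranch
    rw [(hJ.mul_left h).tsum_add (hA.mul_left (f η)), tsum_mul_left, tsum_mul_left] at e1
    rw [tsum_mul_left] at e3
    refine (congrArg₂ _ rfl (congrArg₂ _ (congrArg₂ _ e1 (congrArg₂ _ rfl e3)) rfl)).trans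
      (Eq.trans ?_ (congrArg₂ _ e2 rfl).symm)
    field_simp
    ring
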